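/- If a stage i of a Runge–Kutta method (A,b,c) is of strong stage order at least p, then stage i is of stage order at least p, i.e. Σ_j a_{ij} Φ_j(t) = c_i^{|t|}/t! for every rooted tree t with |t| ≤ p. -/

import Mathlib

/-- Rooted trees: `node ts` is the tree obtained by connecting the roots of the
trees in `ts` by new edges to a new root vertex; `node []` is the one-vertex tree `•`. -/
inductive RTree where
  | node : List RTree → RTree

namespace RTree

/-- The order `|t|` of a rooted tree: its number of vertices. -/
def order : RTree → ℕ
  | node ts => 1 + (ts.attach.map fun x => order x.1).sum
decreasing_by
  simp only [RTree.node.sizeOf_spec]; have := List.sizeOf_lt_of_mem x.2; omega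

/-- The tree factorial: `•! = 1` and `[t₁…tₙ]! = |[t₁…tₙ]| ⬝ ∏ₘ tₘ!`. -/
def factorial : RTree → ℕ
  | node ts => (node ts).order * (ts.attach.map fun x => factorial x.1).prod
decreasing_by
  simp only [RTree.node.sizeOf_spec]; have := List.sizeOf_lt_of_mem x.2; omega

end RTree

/-- Derivative weights: `Φ(•) = 𝟙` and `Φ([t₁…tₙ]) = ∏ₘ (A·Φ(tₘ))`, element-wise. -/
def Phi {s : ℕ} (A : Matrix (Fin s) (Fin s) ℝ) : RTree → Fin s → ℝ
  | .node ts => fun i => (ts.attach.map fun x => A.mulVec (Phi A x.1) i).prod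
decreasing_by
  simp only [RTree.node.sizeOf_spec]; have := List.sizeOf_lt_of_mem x.2; omega

/-- Subquadrature vectors: `q_{n,i} = Σ_j a_{ij} c_j^n − c_i^{n+1}/(n+1)`. -/
noncomputable def qvec {s : ℕ} (A : Matrix (Fin s) (Fin s) ℝ) (c : Fin s → ℝ) (n : ℕ) (i : Fin s) : ℝ :=
  (∑ j, A i j * c j ^ n) - c i ^ (n + 1) / ((n : ℝ) + 1)

/-- Strong stage order: every stage has strong stage order at least 0, and stage `i`
has strong stage order at least `p ≥ 1` if `q_{n,i} = 0` for all `0 ≤ n < p` and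
every stage `j` with `a_{ij} ≠ 0` has strong stage order at least `p − 1`. -/
def StrongStageOrder {s : ℕ} (A : Matrix (Fin s) (Fin s) ℝ) (c : Fin s → ℝ) :
    ℕ → Fin s → Prop
  | 0, _ => True
  | p + 1, i => (∀ n < p + 1, qvec A c n i = 0) ∧
      ∀ j, A i j ≠ 0 → StrongStageOrder A c p j

theorem RTree.order_node (ts : List RTree) :
    (RTree.node ts).order = 1 + (ts.map RTree.order).sum := by
  rw [RTree.order, List.attach_map_val (f := RTree.order)]

theorem RTree.factorial_node (ts : List RTree) :
    (RTree.node ts).factorial = (RTree.node ts).order * (ts.map RTree.factorial).prod := by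
  rw [RTree.factorial, List.attach_map_val (f := RTree.factorial)]

theorem Phi_node {s : ℕ} (A : Matrix (Fin s) (Fin s) ℝ) (ts : List RTree) (i : Fin s) :
    Phi A (.node ts) i = (ts.map fun t => ∑ j, A i j * Phi A t j).prod := by
  rw [Phi]
  exact congrArg List.prod (List.attach_map_val (f := fun t => A.mulVec (Phi A t) i))

theorem RTree.order_le_sum_of_mem {t : RTree} {ts : List RTree} (h : t ∈ ts) :
    t.order ≤ (ts.map RTree.order).sum :=
  List.le_sum_of_mem (List.mem_map_of_mem h)

/-- If every child `t` satisfies `Σ_k a_{jk} Φ_k(t) = c_j^{|t|}/t!`, the derivative weight of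
the joined tree at stage `j` is the corresponding monomial in `c_j`. -/
theorem Phi_node_eq_pow_div {s : ℕ} (A : Matrix (Fin s) (Fin s) ℝ) (c : Fin s → ℝ)
    (j : Fin s) (ts : List RTree)
    (h : ∀ t ∈ ts, ∑ k, A j k * Phi A t k = c j ^ t.order / (t.factorial : ℝ)) :
    Phi A (.node ts) j =
      c j ^ (ts.map RTree.order).sum / ((ts.map RTree.factorial).prod : ℕ) := by
  rw [Phi_node, List.map_congr_left h]
  clear h
  induction ts with
  | nil => simp
  | cons t ts ih =>
    simp only [List.map_cons, List.prod_cons, List.sum_cons, Nat.cast_mul, ih, pow_add]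
    rw [div_mul_div_comm]

/-- If a stage is of strong stage order at least `p`, then it is of stage order
at least `p`. -/
theorem stageOrder_of_strongStageOrder {s : ℕ} (A : Matrix (Fin s) (Fin s) ℝ)
    (b c : Fin s → ℝ) (p : ℕ) (i : Fin s) (h : StrongStageOrder A c p i) :
    ∀ t : RTree, t.order ≤ p →
      ∑ j, A i j * Phi A t j = c i ^ t.order / (t.factorial : ℝ) := by
  induction p generalizing i with
  | zero =>
    rintro ⟨ts⟩ ht
    rw [RTree.order_node] at ht
    omega
  | succ p ih =>
    rintro ⟨ts⟩ ht
    obtain ⟨hq, hA⟩ := h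
    rw [RTree.order_node] at ht
    have hterm : ∀ j, A i j * Phi A (.node ts) j =
        A i j * c j ^ (ts.map RTree.order).sum / ((ts.map RTree.factorial).prod : ℕ) := by
      intro j
      by_cases hj : A i j = 0
      · simp [hj]
      · rw [Phi_node_eq_pow_div A c j ts fun t hmem =>
          ih j (hA j hj) t (by have := RTree.order_le_sum_of_mem hmem; omega), mul_div_assoc]
    have hsum := sub_eq_zero.mp (hq (ts.map RTree.order).sum (by omega))
    rw [Finset.sum_congr rfl fun j _ => hterm j, ← Finset.sum_div, hsum,
      RTree.factorial_node, RTree.order_node, div_div, add_comm 1]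
    push_cast
    rfl
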